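/- For every positive integer b, the number of overpartitions of 5^{2b} is congruent to 1 modulo 5, i.e. P̄(5^{2b}) ≡ 1 (mod 5). -/

import Mathlib

noncomputable section

/-- Number of partitions of `n`. -/
def numPartitions (n : ℕ) : ℕ := Fintype.card (Nat.Partition n)

/-- Number of partitions of `n` into distinct parts. -/
def numDistinctPartitions (n : ℕ) : ℕ := (Nat.Partition.distincts n).card

/-- The number of overpartitions of `n`: `P̄(n) = Σ_{j=0}^{n} d(j)·p(n−j)`. -/
def overPartitions (n : ℕ) : ℕ :=
  ∑ j ∈ Finset.range (n + 1), numDistinctPartitions j * numPartitions (n - j)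

/-- The square of an integer, as a natural number. -/
def sqNorm₁ (x : ℤ) : ℕ := x.natAbs ^ 2

/-- The squared length of a vector of `ℤ²`. -/
def sqNorm₂ (v : ℤ × ℤ) : ℕ := sqNorm₁ v.1 + sqNorm₁ v.2

/-- The squared length of a vector of `ℤ³`. -/
def sqNorm₃ (v : ℤ × ℤ × ℤ) : ℕ := sqNorm₁ v.1 + sqNorm₂ v.2

/-- The squared length of a vector of `ℤ⁴`. -/
def sqNorm₄ (v : (ℤ × ℤ) × ℤ × ℤ) : ℕ := sqNorm₂ v.1 + sqNorm₂ v.2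

theorem cast_sqNorm₃ (v : ℤ × ℤ × ℤ) :
    (sqNorm₃ v : ℤ) = v.1 ^ 2 + v.2.1 ^ 2 + v.2.2 ^ 2 := by
  simp [sqNorm₃, sqNorm₂, sqNorm₁, add_assoc]

theorem cast_sqNorm₄ (v : (ℤ × ℤ) × ℤ × ℤ) :
    (sqNorm₄ v : ℤ) = v.1.1 ^ 2 + v.1.2 ^ 2 + v.2.1 ^ 2 + v.2.2 ^ 2 := by
  simp [sqNorm₄, sqNorm₂, sqNorm₁, add_assoc]

instance finite_sqNorm₁_fiber (n : ℕ) : Finite {x : ℤ // sqNorm₁ x = n} := by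
  refine Set.Finite.subset (Set.finite_Icc (-(n : ℤ)) n) fun x hx ↦ ?_
  have h : x.natAbs ^ 2 = n := hx
  have : x.natAbs ≤ n := h ▸ Nat.le_self_pow two_ne_zero _
  simp only [Set.mem_Icc]
  omega

/-- Splitting the fibre of a sum `f a + g b` according to the values of `f a` and `g b`. -/
def fiberAddEquiv {α β : Type*} (f : α → ℕ) (g : β → ℕ) (n : ℕ) :
    {p : α × β // f p.1 + g p.2 = n} ≃
      Σ q : Finset.HasAntidiagonal.antidiagonal n, {a // f a = q.1.1} × {b // g b = q.1.2} where
  toFun p := ⟨⟨(f p.1.1, g p.1.2), Finset.HasAntidiagonal.mem_antidiagonal.2 p.2⟩,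
    ⟨p.1.1, rfl⟩, ⟨p.1.2, rfl⟩⟩
  invFun s := ⟨(s.2.1.1, s.2.2.1), by
    rw [s.2.1.2, s.2.2.2]; exact Finset.HasAntidiagonal.mem_antidiagonal.1 s.1.2⟩
  left_inv _ := rfl
  right_inv := by
    rintro ⟨⟨⟨i, j⟩, h⟩, ⟨a, ha⟩, ⟨b, hb⟩⟩
    dsimp only at ha hb
    subst ha hb
    rfl

instance finite_sqNorm₂_fiber (n : ℕ) : Finite {v : ℤ × ℤ // sqNorm₂ v = n} :=
  Finite.of_equiv _ (fiberAddEquiv sqNorm₁ sqNorm₁ n).symm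

instance finite_sqNorm₃_fiber (n : ℕ) : Finite {v : ℤ × ℤ × ℤ // sqNorm₃ v = n} :=
  Finite.of_equiv _ (fiberAddEquiv sqNorm₁ sqNorm₂ n).symm

instance finite_sqNorm₄_fiber (n : ℕ) : Finite {v : (ℤ × ℤ) × ℤ × ℤ // sqNorm₄ v = n} :=
  Finite.of_equiv _ (fiberAddEquiv sqNorm₂ sqNorm₂ n).symm

open Classical in
/-- If a family of similitudes `M i` of ratio `k`, indexed by a set of size `1` modulo `m`, covers
every vector of norm `k * n` a number of times that is `1` modulo `m`, then modulo `m` there are as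
many vectors of norm `k * n` as of norm `n`. -/
theorem card_fiber_mul_modEq {ι α : Type*} [Fintype ι] {f : α → ℕ} {k m n : ℕ} (hk : k ≠ 0)
    [Finite {a // f a = n}] [Finite {a // f a = k * n}]
    (M : ι → α → α) (hM : ∀ i, (M i).Injective) (hf : ∀ i a, f (M i a) = k * f a)
    (hι : Fintype.card ι ≡ 1 [MOD m])
    (h : ∀ a, f a = k * n → (Finset.univ.filter fun i ↦ a ∈ Set.range (M i)).card ≡ 1 [MOD m]) :
    Nat.card {a // f a = k * n} ≡ Nat.card {a // f a = n} [MOD m] := by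
  have := Fintype.ofFinite {a // f a = n}
  have := Fintype.ofFinite {a // f a = k * n}
  have key := Finset.sum_card_bipartiteAbove_eq_sum_card_bipartiteBelow
    (s := (Finset.univ : Finset {a // f a = k * n})) (t := (Finset.univ : Finset ι))
    (fun a i ↦ a.1 ∈ Set.range (M i))
  have hcol (i : ι) : (Finset.univ.bipartiteBelow (fun (a : {a // f a = k * n}) (i : ι) ↦
      a.1 ∈ Set.range (M i)) i).card = Nat.card {a // f a = n} := by
    rw [Nat.card_eq_fintype_card, ← Finset.card_univ]
    symm
    refine Finset.card_bij (fun a _ ↦ ⟨M i a.1, by rw [hf, a.2]⟩) ?_ ?_ ?_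
    · simp [Finset.bipartiteBelow]
    · intro a _ b _ hab
      exact Subtype.ext (hM i (Subtype.ext_iff.1 hab))
    · rintro ⟨_, ha⟩ hmem
      obtain ⟨b, rfl⟩ := (Finset.mem_bipartiteBelow _ |>.1 hmem).2
      exact ⟨⟨b, Nat.eq_of_mul_eq_mul_left (Nat.pos_of_ne_zero hk) (by rw [← hf, ha])⟩, by simp⟩
  have hrow : ∑ a : {a // f a = k * n}, (Finset.univ.bipartiteAbove
      (fun (a : {a // f a = k * n}) (i : ι) ↦ a.1 ∈ Set.range (M i)) a).card ≡
      ∑ _a : {a // f a = k * n}, 1 [MOD m] := by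
    rw [Nat.ModEq, Finset.sum_nat_mod, Finset.sum_nat_mod _ _ fun _ ↦ 1]
    exact congrArg (· % m) (Finset.sum_congr rfl fun a _ ↦ h a.1 a.2)
  rw [key] at hrow
  simp only [hcol, Finset.sum_const, Finset.card_univ, smul_eq_mul, mul_one] at hrow
  rw [Nat.card_eq_fintype_card]
  exact hrow.symm.trans (by simpa using hι.mul_right _)

/-- Left multiplications by the quaternions `2 ± i`, `2 ± j`, `2 ± k` of norm `5`. -/
def quaternionMul (i : Fin 3 × ℤˣ) (w : (ℤ × ℤ) × ℤ × ℤ) : (ℤ × ℤ) × ℤ × ℤ :=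
  let e : ℤ := i.2
  if i.1 = 0 then
    ((2 * w.1.1 - e * w.1.2, 2 * w.1.2 + e * w.1.1), 2 * w.2.1 - e * w.2.2, 2 * w.2.2 + e * w.2.1)
  else if i.1 = 1 then
    ((2 * w.1.1 - e * w.2.1, 2 * w.1.2 + e * w.2.2), 2 * w.2.1 + e * w.1.1, 2 * w.2.2 - e * w.1.2)
  else
    ((2 * w.1.1 - e * w.2.2, 2 * w.1.2 - e * w.2.1), 2 * w.2.1 + e * w.1.2, 2 * w.2.2 + e * w.1.1)

/-- The rational rotations by `arctan (4/3)` around the three axes, scaled by `5`. -/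
def scaledRotation (i : Fin 3 × ℤˣ) (w : ℤ × ℤ × ℤ) : ℤ × ℤ × ℤ :=
  let e : ℤ := i.2
  if i.1 = 0 then (3 * w.1 + 4 * e * w.2.1, -4 * e * w.1 + 3 * w.2.1, 5 * w.2.2)
  else if i.1 = 1 then (5 * w.1, 3 * w.2.1 + 4 * e * w.2.2, -4 * e * w.2.1 + 3 * w.2.2)
  else (3 * w.1 + 4 * e * w.2.2, 5 * w.2.1, -4 * e * w.1 + 3 * w.2.2)

theorem sqNorm₄_quaternionMul (i : Fin 3 × ℤˣ) (w : (ℤ × ℤ) × ℤ × ℤ) :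
    sqNorm₄ (quaternionMul i w) = 5 * sqNorm₄ w := by
  obtain ⟨k, e⟩ := i
  zify
  rw [cast_sqNorm₄, cast_sqNorm₄]
  rcases Int.units_eq_one_or e with rfl | rfl <;> fin_cases k <;> simp [quaternionMul] <;> ring

theorem sqNorm₃_scaledRotation (i : Fin 3 × ℤˣ) (w : ℤ × ℤ × ℤ) :
    sqNorm₃ (scaledRotation i w) = 25 * sqNorm₃ w := by
  obtain ⟨k, e⟩ := i
  zify
  rw [cast_sqNorm₃, cast_sqNorm₃]
  rcases Int.units_eq_one_or e with rfl | rfl <;> fin_cases k <;> simp [scaledRotation] <;> ring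

theorem quaternionMul_injective (i : Fin 3 × ℤˣ) : (quaternionMul i).Injective := by
  obtain ⟨k, e⟩ := i
  rintro ⟨⟨a, b⟩, c, d⟩ ⟨⟨a', b'⟩, c', d'⟩ h
  rcases Int.units_eq_one_or e with rfl | rfl <;> fin_cases k <;>
    simp [quaternionMul] at h ⊢ <;> omega

theorem scaledRotation_injective (i : Fin 3 × ℤˣ) : (scaledRotation i).Injective := by
  obtain ⟨k, e⟩ := i
  rintro ⟨a, b, c⟩ ⟨a', b', c'⟩ h
  rcases Int.units_eq_one_or e with rfl | rfl <;> fin_cases k <;>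
    simp [scaledRotation] at h ⊢ <;> omega

theorem mem_range_quaternionMul_iff (i : Fin 3 × ℤˣ) (a b c d : ℤ) :
    ((a, b), c, d) ∈ Set.range (quaternionMul i) ↔
      if i.1 = 0 then 5 ∣ 2 * a + i.2 * b ∧ 5 ∣ 2 * c + i.2 * d
      else if i.1 = 1 then 5 ∣ 2 * a + i.2 * c ∧ 5 ∣ 2 * d + i.2 * b
      else 5 ∣ 2 * a + i.2 * d ∧ 5 ∣ 2 * b + i.2 * c := by
  obtain ⟨k, e⟩ := i
  constructor
  · rintro ⟨⟨⟨a', b'⟩, c', d'⟩, h⟩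
    rcases Int.units_eq_one_or e with rfl | rfl <;> fin_cases k <;>
      simp [quaternionMul] at h ⊢ <;> omega
  · intro h
    fin_cases k
    · refine ⟨(((2 * a + e * b) / 5, (2 * b - e * a) / 5),
        (2 * c + e * d) / 5, (2 * d - e * c) / 5), ?_⟩
      rcases Int.units_eq_one_or e with rfl | rfl <;> simp [quaternionMul] at h ⊢ <;> omega
    · refine ⟨(((2 * a + e * c) / 5, (2 * b - e * d) / 5),
        (2 * c - e * a) / 5, (2 * d + e * b) / 5), ?_⟩
      rcases Int.units_eq_one_or e with rfl | rfl <;> simp [quaternionMul] at h ⊢ <;> omega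
    · refine ⟨(((2 * a + e * d) / 5, (2 * b + e * c) / 5),
        (2 * c - e * b) / 5, (2 * d - e * a) / 5), ?_⟩
      rcases Int.units_eq_one_or e with rfl | rfl <;> simp [quaternionMul] at h ⊢ <;> omega

theorem mem_range_scaledRotation_iff (i : Fin 3 × ℤˣ) (a b c : ℤ) :
    (a, b, c) ∈ Set.range (scaledRotation i) ↔
      if i.1 = 0 then 25 ∣ a + 7 * i.2 * b ∧ 5 ∣ c
      else if i.1 = 1 then 25 ∣ b + 7 * i.2 * c ∧ 5 ∣ a
      else 25 ∣ a + 7 * i.2 * c ∧ 5 ∣ b := by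
  obtain ⟨k, e⟩ := i
  constructor
  · rintro ⟨⟨a', b', c'⟩, h⟩
    rcases Int.units_eq_one_or e with rfl | rfl <;> fin_cases k <;>
      simp [scaledRotation] at h ⊢ <;> omega
  · intro h
    fin_cases k
    · refine ⟨((3 * a - 4 * e * b) / 25, (4 * e * a + 3 * b) / 25, c / 5), ?_⟩
      rcases Int.units_eq_one_or e with rfl | rfl <;> simp [scaledRotation] at h ⊢ <;> omega
    · refine ⟨(a / 5, (3 * b - 4 * e * c) / 25, (4 * e * b + 3 * c) / 25), ?_⟩
      rcases Int.units_eq_one_or e with rfl | rfl <;> simp [scaledRotation] at h ⊢ <;> omega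
    · refine ⟨((3 * a - 4 * e * c) / 25, b / 5, (4 * e * a + 3 * c) / 25), ?_⟩
      rcases Int.units_eq_one_or e with rfl | rfl <;> simp [scaledRotation] at h ⊢ <;> omega

theorem card_quaternionMul_mod_five : ∀ a b c d : ZMod 5, a ^ 2 + b ^ 2 + c ^ 2 + d ^ 2 = 0 →
    (Finset.univ.filter fun i : Fin 3 × ℤˣ ↦
      if i.1 = 0 then 2 * a + (i.2 : ℤ) * b = 0 ∧ 2 * c + (i.2 : ℤ) * d = 0
      else if i.1 = 1 then 2 * a + (i.2 : ℤ) * c = 0 ∧ 2 * d + (i.2 : ℤ) * b = 0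
      else 2 * a + (i.2 : ℤ) * d = 0 ∧ 2 * b + (i.2 : ℤ) * c = 0).card % 5 = 1 := by
  decide +kernel

theorem card_isotropic_lines_mod_five : ∀ a b c : ZMod 5, a ^ 2 + b ^ 2 + c ^ 2 = 0 →
    (Finset.univ.filter fun i : Fin 3 × ℤˣ ↦
      if i.1 = 0 then a + 2 * (i.2 : ℤ) * b = 0
      else if i.1 = 1 then b + 2 * (i.2 : ℤ) * c = 0
      else a + 2 * (i.2 : ℤ) * c = 0).card % 5 = 1 := by
  decide +kernel

theorem card_scaledRotation_mod_twentyFive : ∀ a b c : ZMod 25, a ^ 2 + b ^ 2 + c ^ 2 = 0 →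
    ¬(5 * a = 0 ∧ 5 * b = 0 ∧ 5 * c = 0) →
    (Finset.univ.filter fun i : Fin 3 × ℤˣ ↦
      if i.1 = 0 then a + 7 * (i.2 : ℤ) * b = 0 ∧ 5 * c = 0
      else if i.1 = 1 then b + 7 * (i.2 : ℤ) * c = 0 ∧ 5 * a = 0
      else a + 7 * (i.2 : ℤ) * c = 0 ∧ 5 * b = 0).card % 5 = 1 := by
  decide +kernel

theorem card_sqNorm₄_mul_five (n : ℕ) :
    Nat.card {v // sqNorm₄ v = 5 * n} ≡ Nat.card {v // sqNorm₄ v = n} [MOD 5] := by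
  classical
  refine card_fiber_mul_modEq (by norm_num) quaternionMul quaternionMul_injective
    sqNorm₄_quaternionMul (by decide) ?_
  rintro ⟨⟨a, b⟩, c, d⟩ h
  have hs : (a : ZMod 5) ^ 2 + b ^ 2 + c ^ 2 + d ^ 2 = 0 := by
    have h' := cast_sqNorm₄ ((a, b), c, d)
    rw [h] at h'
    have := (ZMod.intCast_zmod_eq_zero_iff_dvd (a ^ 2 + b ^ 2 + c ^ 2 + d ^ 2) 5).2
      ⟨n, by simpa using h'.symm⟩
    exact_mod_cast this
  have key := card_quaternionMul_mod_five a b c d hs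
  refine Eq.trans ?_ key
  refine congrArg (fun s ↦ Finset.card s % 5) (Finset.filter_congr fun i _ ↦ ?_)
  rw [mem_range_quaternionMul_iff]
  have h5 (x y : ℤ) : 2 * (x : ZMod 5) + (i.2 : ℤ) * y = 0 ↔ 5 ∣ 2 * x + i.2 * y := by
    have := ZMod.intCast_zmod_eq_zero_iff_dvd (2 * x + i.2 * y) 5
    push_cast at this
    exact this
  simp only [h5]

theorem card_sqNorm₃_mul_twentyFive {n : ℕ} (hn : 5 ∣ n) :
    Nat.card {v // sqNorm₃ v = 25 * n} ≡ Nat.card {v // sqNorm₃ v = n} [MOD 5] := by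
  classical
  refine card_fiber_mul_modEq (by norm_num) scaledRotation scaledRotation_injective
    sqNorm₃_scaledRotation (by decide) ?_
  rintro ⟨a, b, c⟩ h
  obtain ⟨m, rfl⟩ := hn
  have hs : a ^ 2 + b ^ 2 + c ^ 2 = 125 * (m : ℤ) := by
    have h' := cast_sqNorm₃ (a, b, c)
    rw [h] at h'
    push_cast at h'
    linarith
  by_cases hdvd : 5 ∣ a ∧ 5 ∣ b ∧ 5 ∣ c
  · obtain ⟨⟨a, rfl⟩, ⟨b, rfl⟩, ⟨c, rfl⟩⟩ := hdvd
    have hs' : (a : ZMod 5) ^ 2 + b ^ 2 + c ^ 2 = 0 := by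
      have := (ZMod.intCast_zmod_eq_zero_iff_dvd (a ^ 2 + b ^ 2 + c ^ 2) 5).2
        ⟨m, by push_cast; linarith⟩
      exact_mod_cast this
    refine Eq.trans ?_ (card_isotropic_lines_mod_five a b c hs')
    refine congrArg (fun s ↦ Finset.card s % 5) (Finset.filter_congr fun i _ ↦ ?_)
    rw [mem_range_scaledRotation_iff]
    have h5 (x y : ℤ) : (x : ZMod 5) + 2 * (i.2 : ℤ) * y = 0 ↔ 25 ∣ 5 * x + 7 * i.2 * (5 * y) := by
      have := ZMod.intCast_zmod_eq_zero_iff_dvd (x + 2 * i.2 * y) 5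
      push_cast at this
      rw [this]
      rcases Int.units_eq_one_or i.2 with hi | hi <;> rw [hi] <;> push_cast <;> omega
    simp only [h5, dvd_mul_right, and_true]
  · have hs' : (a : ZMod 25) ^ 2 + b ^ 2 + c ^ 2 = 0 := by
      have := (ZMod.intCast_zmod_eq_zero_iff_dvd (a ^ 2 + b ^ 2 + c ^ 2) 25).2
        ⟨5 * m, by push_cast; linarith⟩
      exact_mod_cast this
    have h5 (x : ℤ) : 5 * (x : ZMod 25) = 0 ↔ 5 ∣ x := by
      have := ZMod.intCast_zmod_eq_zero_iff_dvd (5 * x) 25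
      push_cast at this
      rw [this]
      omega
    refine Eq.trans ?_ (card_scaledRotation_mod_twentyFive a b c hs' (by simpa only [h5] using hdvd))
    refine congrArg (fun s ↦ Finset.card s % 5) (Finset.filter_congr fun i _ ↦ ?_)
    rw [mem_range_scaledRotation_iff]
    have h25 (x y : ℤ) : (x : ZMod 25) + 7 * (i.2 : ℤ) * y = 0 ↔ 25 ∣ x + 7 * i.2 * y := by
      have := ZMod.intCast_zmod_eq_zero_iff_dvd (x + 7 * i.2 * y) 25
      push_cast at this
      exact this
    simp only [h5, h25]

open PowerSeries

/-- Partial sums of `∑ (-1) ^ j * q ^ (j ^ 2)` over all integers `j`. -/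
def altThetaPartial {R : Type*} [CommRing R] (q : R) (n : ℕ) : R :=
  ∑ j ∈ Finset.Icc (-(n : ℤ)) n, (-1) ^ sqNorm₁ j * q ^ sqNorm₁ j

theorem altThetaPartial_succ {R : Type*} [CommRing R] (q : R) (n : ℕ) :
    altThetaPartial q (n + 1) =
      altThetaPartial q n + 2 * (-1) ^ (n + 1) * q ^ ((n + 1) ^ 2) := by
  have hset : Finset.Icc (-((n + 1 : ℕ) : ℤ)) ((n + 1 : ℕ) : ℤ) =
      insert (-((n + 1 : ℕ) : ℤ)) (insert ((n + 1 : ℕ) : ℤ) (Finset.Icc (-(n : ℤ)) n)) := by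
    ext x
    simp only [Finset.mem_Icc, Finset.mem_insert]
    omega
  have hpar : (-1 : R) ^ ((n + 1) ^ 2) = (-1) ^ (n + 1) := by
    rw [sq, pow_mul]
    rcases neg_one_pow_eq_or R (n + 1) with h | h <;> rw [h]
    · simp
    · exact h
  rw [altThetaPartial, hset, Finset.sum_insert, Finset.sum_insert, altThetaPartial]
  · simp only [sqNorm₁, Int.natAbs_neg, Int.natAbs_natCast, hpar]
    ring
  · simp
  · simp only [Finset.mem_insert, Finset.mem_Icc]
    omega

/-- A finite form of Gauss's identity `∑ (-1) ^ j * q ^ (j ^ 2) = ∏ (1 - q ^ i) / (1 + q ^ i)`. -/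
theorem altThetaPartial_mul_prod {R : Type*} [CommRing R] (q : R) (n : ℕ) :
    altThetaPartial q n * ∏ i ∈ Finset.range n, (1 + q ^ (i + 1)) =
      ∏ i ∈ Finset.range n, (1 - q ^ (i + 1)) +
        2 * ∑ s ∈ Finset.range n, (-1) ^ (s + 1) * q ^ ((s + 1) * (n + 1)) *
          (∏ i ∈ Finset.range s, (1 + q ^ (i + 1))) *
            ∏ i ∈ Finset.Ico (s + 1) n, (1 - q ^ (i + 1)) := by
  induction n with
  | zero => simp [altThetaPartial, sqNorm₁]
  | succ n ih =>
    set D : ℕ → R := fun s ↦ ∏ i ∈ Finset.range s, (1 + q ^ (i + 1)) with hD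
    set M : ℕ → R := fun s ↦ ∏ i ∈ Finset.Ico s n, (1 - q ^ (i + 1)) with hM
    let h : ℕ → R := fun s ↦ (-1) ^ (s + 1) * q ^ ((s + 1) * (n + 1)) * D s * M s
    have hDs (s : ℕ) : D (s + 1) = D s * (1 + q ^ (s + 1)) := Finset.prod_range_succ _ _
    have hMs {s : ℕ} (hs : s < n) : M s = (1 - q ^ (s + 1)) * M (s + 1) :=
      Finset.prod_eq_prod_Ico_succ_bot hs _
    have hN : ∏ i ∈ Finset.range n, (1 - q ^ (i + 1)) = M 0 := by rw [hM, Finset.range_eq_Ico]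
    have hsum : ∑ s ∈ Finset.range (n + 1), (-1) ^ (s + 1) * q ^ ((s + 1) * (n + 1 + 1)) * D s *
          ∏ i ∈ Finset.Ico (s + 1) (n + 1), (1 - q ^ (i + 1)) =
        (1 + q ^ (n + 1)) * ∑ s ∈ Finset.range n, (-1) ^ (s + 1) * q ^ ((s + 1) * (n + 1)) * D s *
          M (s + 1) + (h n - h 0) + (-1) ^ (n + 1) * q ^ ((n + 1) * (n + 1 + 1)) * D n := by
      rw [Finset.sum_range_succ, Finset.Ico_self, Finset.prod_empty, mul_one,
        ← Finset.sum_range_sub h, Finset.mul_sum, ← Finset.sum_add_distrib]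
      congr 1
      refine Finset.sum_congr rfl fun s hs ↦ ?_
      have hs' := Finset.mem_range.1 hs
      rw [Finset.prod_Ico_succ_top (by omega)]
      simp only [h, hMs hs', hDs]
      change _ * (M (s + 1) * _) = _
      ring
    rw [hsum, Finset.prod_range_succ (fun i ↦ 1 + q ^ (i + 1)), Finset.prod_range_succ,
      altThetaPartial_succ, hN]
    have hMn : M n = 1 := by simp [hM]
    have hD0 : D 0 = 1 := by simp [hD]
    rw [hN] at ih
    change _ * D n = _ at ih
    simp only [h, hMn, hD0]
    change _ * (D n * _) = _
    linear_combination (1 + q ^ (n + 1)) * ih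

/-- The generating function of the fibre cardinalities of `f`, with coefficients modulo `5`. -/
def fiberSeries {α : Type*} (f : α → ℕ) : (ZMod 5)⟦X⟧ :=
  PowerSeries.mk fun n ↦ (Nat.card {a // f a = n} : ZMod 5)

/-- The theta series `∑ X ^ (j ^ 2)` over all integers `j`, modulo `5`. -/
abbrev thetaSeries : (ZMod 5)⟦X⟧ := fiberSeries sqNorm₁

theorem coeff_altThetaPartial {d n : ℕ} (h : d ≤ n) :
    coeff d (altThetaPartial (X : (ZMod 5)⟦X⟧) n) = coeff d (rescale (-1) thetaSeries) := by
  have hterm (j : ℤ) : coeff d ((-1) ^ sqNorm₁ j * (X : (ZMod 5)⟦X⟧) ^ sqNorm₁ j) =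
      if sqNorm₁ j = d then (-1) ^ d else 0 := by
    rw [show (-1 : (ZMod 5)⟦X⟧) ^ sqNorm₁ j = C ((-1) ^ sqNorm₁ j) by simp, coeff_C_mul,
      coeff_X_pow]
    split_ifs <;> grind
  rw [altThetaPartial, map_sum, Finset.sum_congr rfl fun j _ ↦ hterm j, ← Finset.sum_filter,
    Finset.sum_const, coeff_rescale, thetaSeries, fiberSeries, coeff_mk,
    Nat.subtype_card, nsmul_eq_mul, mul_comm]
  intro x
  rw [Finset.mem_filter, Finset.mem_Icc, and_iff_right_iff_imp]
  intro hx
  have : x.natAbs ≤ d := hx ▸ Nat.le_self_pow two_ne_zero _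
  omega

/-- The generating function of partitions into distinct parts, modulo `5`. -/
def distinctSeries : (ZMod 5)⟦X⟧ :=
  PowerSeries.mk fun n ↦ ((Nat.Partition.distincts n).card : ZMod 5)

/-- The generating function of partitions, modulo `5`. -/
def partitionSeries : (ZMod 5)⟦X⟧ :=
  PowerSeries.mk fun n ↦ (Fintype.card (Nat.Partition n) : ZMod 5)

open scoped PowerSeries.WithPiTopology

theorem hasProd_distinctSeries [TopologicalSpace (ZMod 5)] [T2Space (ZMod 5)] :
    HasProd (fun i ↦ 1 + (X : (ZMod 5)⟦X⟧) ^ (i + 1)) distinctSeries := by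
  have h := Nat.Partition.hasProd_powerSeriesMk_card_countRestricted (ZMod 5) (m := 2) (by norm_num)
  simp_rw [Nat.Partition.countRestricted_two] at h
  refine h.congr_fun ?_
  simp [Finset.sum_range_succ]

theorem hasProd_partitionSeries [TopologicalSpace (ZMod 5)] [T2Space (ZMod 5)]
    [IsTopologicalRing (ZMod 5)] :
    HasProd (fun i ↦ ∑' j : ℕ, (X : (ZMod 5)⟦X⟧) ^ ((i + 1) * j)) partitionSeries := by
  have := Nat.Partition.hasProd_powerSeriesMk_card_restricted (ZMod 5) (fun _ ↦ True)
  simpa [Nat.Partition.restricted] using! this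

/-- Gauss's identity: the overpartition series is the inverse of `∑ (-1) ^ j * X ^ (j ^ 2)`. -/
theorem theta_mul_overpartition :
    rescale (-1) thetaSeries * (distinctSeries * partitionSeries) = 1 := by
  let _ : TopologicalSpace (ZMod 5) := ⊥
  have : DiscreteTopology (ZMod 5) := ⟨rfl⟩
  have hE := WithPiTopology.hasProd_one_sub_X_pow (ZMod 5)
  set E : (ZMod 5)⟦X⟧ := pentagonalSeries (ZMod 5)
  have hPE : partitionSeries * E = 1 := by
    refine (hasProd_partitionSeries.mul hE).unique ?_
    convert! hasProd_one (α := (ZMod 5)⟦X⟧) (β := ℕ) with i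
    simp_rw [pow_mul]
    exact WithPiTopology.tsum_pow_mul_one_sub_of_constantCoeff_eq_zero (by simp)
  have hS : Filter.Tendsto (altThetaPartial (X : (ZMod 5)⟦X⟧)) Filter.atTop
      (nhds (rescale (-1) thetaSeries)) := by
    rw [WithPiTopology.tendsto_iff_coeff_tendsto]
    exact fun d ↦ tendsto_atTop_of_eventually_const fun n hn ↦ coeff_altThetaPartial hn
  have hlim := hS.mul hasProd_distinctSeries.tendsto_prod_nat
  have hlim' : Filter.Tendsto (fun n ↦ altThetaPartial (X : (ZMod 5)⟦X⟧) n *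
      ∏ i ∈ Finset.range n, (1 + (X : (ZMod 5)⟦X⟧) ^ (i + 1))) Filter.atTop (nhds (E + 0)) := by
    simp_rw [altThetaPartial_mul_prod]
    refine hE.tendsto_prod_nat.add ?_
    rw [WithPiTopology.tendsto_iff_coeff_tendsto]
    refine fun d ↦ tendsto_atTop_of_eventually_const (i₀ := d) fun n hn ↦ ?_
    rw [map_zero]
    refine X_pow_dvd_iff.1 (?_ : X ^ (n + 1) ∣ _) d (by omega)
    refine Dvd.dvd.mul_left (Finset.dvd_sum fun s _ ↦ ?_) _
    refine Dvd.dvd.mul_right (Dvd.dvd.mul_right (Dvd.dvd.mul_left (pow_dvd_pow _ ?_) _) _) _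
    exact Nat.le_mul_of_pos_left _ (Nat.succ_pos s)
  have hEq := tendsto_nhds_unique hlim hlim'
  rw [← mul_assoc, hEq, add_zero, mul_comm, hPE]

theorem fiberSeries_add {α β : Type*} (f : α → ℕ) (g : β → ℕ)
    [∀ n, Finite {a // f a = n}] [∀ n, Finite {b // g b = n}] :
    fiberSeries (fun p : α × β ↦ f p.1 + g p.2) = fiberSeries f * fiberSeries g := by
  ext n
  rw [coeff_mul, fiberSeries, coeff_mk, Nat.card_congr (fiberAddEquiv f g n), Nat.card_sigma,
    Nat.cast_sum]
  simp only [fiberSeries, coeff_mk, Nat.card_prod, Nat.cast_mul]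
  exact Finset.sum_coe_sort (Finset.HasAntidiagonal.antidiagonal n)
    fun q ↦ (Nat.card {a // f a = q.1} : ZMod 5) * Nat.card {b // g b = q.2}

theorem fiberSeries_sqNorm₃ : fiberSeries sqNorm₃ = thetaSeries ^ 3 := by
  have h₂ : fiberSeries sqNorm₂ = thetaSeries * thetaSeries := fiberSeries_add sqNorm₁ sqNorm₁
  have h₃ : fiberSeries sqNorm₃ = thetaSeries * fiberSeries sqNorm₂ :=
    fiberSeries_add sqNorm₁ sqNorm₂
  rw [h₃, h₂]
  ring

theorem fiberSeries_sqNorm₄ : fiberSeries sqNorm₄ = thetaSeries ^ 4 := by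
  have h₂ : fiberSeries sqNorm₂ = thetaSeries * thetaSeries := fiberSeries_add sqNorm₁ sqNorm₁
  have h₄ : fiberSeries sqNorm₄ = fiberSeries sqNorm₂ * fiberSeries sqNorm₂ :=
    fiberSeries_add sqNorm₂ sqNorm₂
  rw [h₄, h₂]
  ring

/-- The operator keeping the coefficients whose index is a multiple of `p`. -/
def contract {R : Type*} [Semiring R] (p : ℕ) (f : R⟦X⟧) : R⟦X⟧ :=
  PowerSeries.mk fun n ↦ coeff (p * n) f

theorem contract_expand_mul {R : Type*} [CommRing R] {p : ℕ} (hp : p ≠ 0) (f g : R⟦X⟧) :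
    contract p (expand p hp f * g) = f * contract p g := by
  ext n
  rw [contract, coeff_mk, coeff_mul, coeff_mul]
  symm
  refine Finset.sum_of_injOn (fun q ↦ (p * q.1, p * q.2)) ?_ ?_ ?_ ?_
  · intro x _ y _ h
    simpa [hp, Prod.ext_iff] using h
  · intro x hx
    simp only [Finset.mem_coe, Finset.HasAntidiagonal.mem_antidiagonal] at hx ⊢
    rw [← hx, mul_add]
  · rintro ⟨i, j⟩ hij hnot
    rw [coeff_expand_of_not_dvd, zero_mul]
    rintro ⟨i, rfl⟩
    rw [Finset.HasAntidiagonal.mem_antidiagonal] at hij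
    obtain ⟨j, rfl⟩ : p ∣ j := (Nat.dvd_add_right (Dvd.intro _ rfl)).1 (Dvd.intro _ hij.symm)
    refine hnot ⟨(i, j), ?_, rfl⟩
    rw [Finset.mem_coe, Finset.HasAntidiagonal.mem_antidiagonal]
    exact Nat.eq_of_mul_eq_mul_left (Nat.pos_of_ne_zero hp) (by rw [mul_add]; exact hij)
  · intro q _
    rw [coeff_expand_mul, contract, coeff_mk]

theorem expand_five_eq_pow (f : (ZMod 5)⟦X⟧) : expand 5 (by norm_num) f = f ^ 5 := by
  have : Fact (Nat.Prime 5) := ⟨by norm_num⟩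
  have h := MvPowerSeries.map_frobenius_expand (R := ZMod 5) 5 (by norm_num) (f := f)
  rw [ZMod.frobenius_zmod, MvPowerSeries.map_id] at h
  exact h

theorem contract_theta_pow_four : contract 5 (thetaSeries ^ 4) = thetaSeries ^ 4 := by
  rw [← fiberSeries_sqNorm₄]
  ext n
  rw [contract, coeff_mk, fiberSeries, coeff_mk, coeff_mk, ZMod.natCast_eq_natCast_iff]
  exact card_sqNorm₄_mul_five n

theorem contract_rescale_overpartition :
    contract 5 (rescale (-1) (distinctSeries * partitionSeries)) = thetaSeries ^ 3 := by
  set G := rescale (-1) (distinctSeries * partitionSeries) with hG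
  have hθ : thetaSeries * G = 1 := by
    have := congrArg (rescale (-1)) theta_mul_overpartition
    rwa [map_mul, rescale_rescale, map_one, neg_one_mul, neg_neg, rescale_one] at this
  have h : thetaSeries ^ 4 = thetaSeries * contract 5 G := by
    rw [← contract_expand_mul (by norm_num), expand_five_eq_pow, pow_succ _ 4, mul_assoc, hθ,
      mul_one, contract_theta_pow_four]
  linear_combination -G * h + (thetaSeries ^ 3 - contract 5 G) * hθ

theorem coeff_overpartition (n : ℕ) :
    coeff n (distinctSeries * partitionSeries) = (overPartitions n : ZMod 5) := by
  rw [coeff_mul, Finset.Nat.sum_antidiagonal_eq_sum_range_succ_mk, overPartitions]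
  simp [distinctSeries, partitionSeries, numDistinctPartitions, numPartitions]

theorem overPartitions_five_mul (n : ℕ) :
    (-1) ^ (5 * n) * (overPartitions (5 * n) : ZMod 5) = Nat.card {v // sqNorm₃ v = n} := by
  have h := congrArg (coeff n) contract_rescale_overpartition
  rwa [← fiberSeries_sqNorm₃, contract, coeff_mk, coeff_rescale, coeff_overpartition, fiberSeries,
    coeff_mk] at h

theorem card_sqNorm₃_five : Nat.card {v // sqNorm₃ v = 5} = 24 := by
  have h := Nat.subtype_card (p := fun v ↦ sqNorm₃ v = 5)
    ((Finset.Icc (-2 : ℤ) 2 ×ˢ Finset.Icc (-2 : ℤ) 2 ×ˢ Finset.Icc (-2 : ℤ) 2).filter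
      fun v ↦ sqNorm₃ v = 5) fun v ↦ by
    simp only [Finset.mem_filter, Finset.mem_product, Finset.mem_Icc, and_iff_right_iff_imp]
    intro hv
    have := cast_sqNorm₃ v
    rw [hv] at this
    push_cast at this
    refine ⟨⟨?_, ?_⟩, ⟨?_, ?_⟩, ?_, ?_⟩ <;>
      nlinarith [sq_nonneg v.1, sq_nonneg v.2.1, sq_nonneg v.2.2]
  rw [h]
  decide +kernel

theorem card_sqNorm₃_five_mul_pow (k : ℕ) :
    Nat.card {v // sqNorm₃ v = 5 * 25 ^ k} ≡ 24 [MOD 5] := by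
  induction k with
  | zero => rw [pow_zero, mul_one, card_sqNorm₃_five]
  | succ k ih =>
    rw [pow_succ', mul_left_comm]
    exact (card_sqNorm₃_mul_twentyFive (dvd_mul_right _ _)).trans ih

/-- For every positive integer `b`, `P̄(5^{2b}) ≡ 1 (mod 5)`. -/
theorem statement3 : ∀ b : ℕ, 0 < b → overPartitions (5 ^ (2 * b)) ≡ 1 [MOD 5] := by
  rintro (_ | k) hb
  · simp at hb
  have hpow : 5 ^ (2 * (k + 1)) = 5 * (5 * 25 ^ k) := by
    rw [mul_add, pow_add, pow_mul]
    ring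
  have hodd : Odd (5 * (5 * 25 ^ k)) := hpow ▸ Odd.pow (by decide)
  have h := overPartitions_five_mul (5 * 25 ^ k)
  rw [hodd.neg_one_pow, (ZMod.natCast_eq_natCast_iff _ _ _).2 (card_sqNorm₃_five_mul_pow k)] at h
  rw [← ZMod.natCast_eq_natCast_iff, hpow]
  have h24 : ((24 : ℕ) : ZMod 5) = -1 := by decide
  rw [h24] at h
  push_cast
  linear_combination -h

end
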